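/- Let v = (v₀, v₁, …, v₈) ∈ ℤ⁹. Then v is a (−1)-class for the Lorentzian form ⟨a,b⟩ = a₀b₀ − Σ_{i=1}^{8} aᵢbᵢ with κ = (−3,−1,…,−1) (that is, ⟨v,v⟩ = −1 and ⟨v,κ⟩ = −1) if and only if there is a permutation σ of the indices {1,…,8} such that (v₀, v_{σ(1)}, …, v_{σ(8)}) is one of the following seven vectors: (0,−1,0,0,0,0,0,0,0) [exceptional curve], (1,1,1,0,0,0,0,0,0) [line through 2 points], (2,1,1,1,1,1,0,0,0) [conic through 5 points], (3,2,1,1,1,1,1,1,0) [cubic through 7 points, nodal at one], (4,2,2,2,1,1,1,1,1) [quartic with 3 nodes], (5,2,2,2,2,2,2,1,1) [quintic with 6 nodes], (6,3,2,2,2,2,2,2,2) [sextic with 7 nodes and one triple point]. -/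

import Mathlib

/-- The Lorentzian intersection form on the Picard lattice `ℤ^{r+1}` of a del Pezzo
surface: `⟨a,b⟩ = a₀b₀ − Σ_{i=1}^{r} aᵢbᵢ`. -/
def lorentzForm {r : ℕ} (a b : Fin (r + 1) → ℤ) : ℤ :=
  a 0 * b 0 - ∑ i : Fin r, a i.succ * b i.succ

/-- The canonical class `κ = (−3,−1,…,−1)`. -/
def kappa {r : ℕ} : Fin (r + 1) → ℤ := Fin.cons (-3) fun _ => -1

/-- Being a `(−1)`-class amounts to prescribing the sum and the sum of squares of the last
coordinates. -/
theorem lorentzForm_self_and_kappa_iff {r : ℕ} (v : Fin (r + 1) → ℤ) :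
    (lorentzForm v v = -1 ∧ lorentzForm v kappa = -1) ↔
      ∑ i : Fin r, v i.succ = 3 * v 0 - 1 ∧ ∑ i : Fin r, v i.succ ^ 2 = v 0 ^ 2 + 1 := by
  simp only [lorentzForm, kappa, Fin.cons_zero, Fin.cons_succ, mul_neg, mul_one,
    Finset.sum_neg_distrib, ← sq]
  constructor <;> rintro ⟨h₁, h₂⟩ <;> constructor <;> linarith

theorem Int.sub_mul_sub_add_one_nonneg (x c : ℤ) : 0 ≤ (x - c) * (x - (c + 1)) := by
  rcases le_or_gt x c with hx | hx
  · exact mul_nonneg_of_nonpos_of_nonpos (by lia) (by lia)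
  · exact mul_nonneg (by lia) (by lia)

theorem sum_sub_mul_sub_add_one {ι : Type*} [Fintype ι] (f : ι → ℤ) (c : ℤ) :
    ∑ i, (f i - c) * (f i - (c + 1)) =
      ∑ i, f i ^ 2 - (2 * c + 1) * ∑ i, f i + Fintype.card ι * (c * (c + 1)) := by
  have hterm : ∀ i, (f i - c) * (f i - (c + 1)) =
      f i ^ 2 - (2 * c + 1) * f i + c * (c + 1) := fun i => by ring
  simp only [hterm, Finset.sum_add_distrib, Finset.sum_sub_distrib, ← Finset.mul_sum,
    Finset.sum_const, Finset.card_univ, nsmul_eq_mul]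
  ring

theorem le_sum_sq {ι : Type*} [Fintype ι] (f : ι → ℤ) (c : ℤ) :
    (2 * c + 1) * ∑ i, f i - Fintype.card ι * (c * (c + 1)) ≤ ∑ i, f i ^ 2 := by
  have h : 0 ≤ ∑ i, (f i - c) * (f i - (c + 1)) :=
    Finset.sum_nonneg fun i _ => Int.sub_mul_sub_add_one_nonneg (f i) c
  rw [sum_sub_mul_sub_add_one] at h
  linarith

/-- The equality case of `le_sum_sq`. -/
theorem eq_or_eq_add_one_of_sum_sq {ι : Type*} [Fintype ι] {f : ι → ℤ} (c : ℤ)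
    (h : ∑ i, f i ^ 2 = (2 * c + 1) * ∑ i, f i - Fintype.card ι * (c * (c + 1))) (i : ι) :
    f i = c ∨ f i = c + 1 := by
  have hsum : ∑ i, (f i - c) * (f i - (c + 1)) = 0 := by
    rw [sum_sub_mul_sub_add_one, h]
    ring
  have hzero := (Finset.sum_eq_zero_iff_of_nonneg
    fun i _ => Int.sub_mul_sub_add_one_nonneg (f i) c).1 hsum i (Finset.mem_univ i)
  simpa [sub_eq_zero] using hzero

/-- The degree of a `(−1)`-class on a del Pezzo surface of degree 1 is between 0 and 6. -/
theorem degree_mem_Icc {d : ℤ} {f : Fin 8 → ℤ} (hsum : ∑ i, f i = 3 * d - 1)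
    (hsq : ∑ i, f i ^ 2 = d ^ 2 + 1) : d ∈ Set.Icc 0 6 := by
  have hcs := sq_sum_le_card_mul_sum_sq (s := Finset.univ) (f := f)
  simp only [hsum, hsq, Finset.card_univ, Fintype.card_fin, Nat.cast_ofNat] at hcs
  have hlo : -1 ≤ d := by nlinarith
  have hhi : d ≤ 7 := by nlinarith
  have hne_lo : d ≠ -1 := by
    rintro rfl
    have h := le_sum_sq f (-1)
    norm_num [hsum, hsq] at h
  have hne_hi : d ≠ 7 := by
    rintro rfl
    have h := le_sum_sq f 2
    norm_num [hsum, hsq] at h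
  exact ⟨by lia, by lia⟩

/-- An antitone integer vector of length 8 with the sum and sum of squares of a `(−1)`-class of
degree 3 is `(2,1,1,1,1,1,1,0)`. -/
theorem eq_of_antitone_of_sum_eq_eight {f : Fin 8 → ℤ} (hf : Antitone f) (hsum : ∑ i, f i = 8)
    (hsq : ∑ i, f i ^ 2 = 10) : f = ![2, 1, 1, 1, 1, 1, 1, 0] := by
  have hle₀ : ∀ i, f i ≤ f 0 := fun i => hf (Fin.zero_le i)
  have hle₇ : ∀ i, f 7 ≤ f i := fun i => hf (Fin.le_last i)
  have hdev : ∑ i, (f i - 1) ^ 2 = 2 := by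
    have hterm : ∀ i, (f i - 1) ^ 2 = f i ^ 2 - 2 * f i + 1 := fun i => by ring
    simp [hterm, Finset.sum_add_distrib, Finset.sum_sub_distrib, ← Finset.mul_sum, hsum, hsq]
  simp only [Fin.sum_univ_eight] at hsum hdev
  simp only [Fin.forall_fin_succ] at hle₀ hle₇
  simp at hle₀ hle₇
  have hconst : ¬ (f 0 = 1 ∧ f 1 = 1 ∧ f 2 = 1 ∧ f 3 = 1 ∧ f 4 = 1 ∧ f 5 = 1 ∧ f 6 = 1 ∧
      f 7 = 1) := by
    rintro ⟨h0, h1, h2, h3, h4, h5, h6, h7⟩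
    simp [h0, h1, h2, h3, h4, h5, h6, h7] at hdev
  have h0 : 2 ≤ f 0 := by clear hdev; lia
  have h7 : f 7 ≤ 0 := by clear hdev; lia
  have hne : ∀ i, f i ≠ 1 → 1 ≤ (f i - 1) ^ 2 := fun i hi => sq_pos_of_ne_zero (sub_ne_zero.2 hi)
  have hs0 := hne 0 (by lia)
  have hs7 := hne 7 (by lia)
  have hmid : ∀ i, (f i - 1) ^ 2 ≤ 0 → f i = 1 := fun i hi => by
    have := pow_eq_zero_iff two_ne_zero |>.1 (le_antisymm hi (sq_nonneg _))
    lia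
  have hpos : ∀ i, 0 ≤ (f i - 1) ^ 2 := fun i => sq_nonneg _
  have h1 := hmid 1 (by linarith [hpos 2, hpos 3, hpos 4, hpos 5, hpos 6])
  have h2 := hmid 2 (by linarith [hpos 1, hpos 3, hpos 4, hpos 5, hpos 6])
  have h3 := hmid 3 (by linarith [hpos 1, hpos 2, hpos 4, hpos 5, hpos 6])
  have h4 := hmid 4 (by linarith [hpos 1, hpos 2, hpos 3, hpos 5, hpos 6])
  have h5 := hmid 5 (by linarith [hpos 1, hpos 2, hpos 3, hpos 4, hpos 6])
  have h6 := hmid 6 (by linarith [hpos 1, hpos 2, hpos 3, hpos 4, hpos 5])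
  have hsq0 : (f 0 - 1) ^ 2 ≤ 1 := by
    linarith [hpos 1, hpos 2, hpos 3, hpos 4, hpos 5, hpos 6]
  have h0' : f 0 ≤ 2 := by nlinarith only [hsq0, h0]
  clear hdev hs0 hs7 hsq0 hsq
  ext i
  fin_cases i <;> simp <;> lia

/-- An antitone integer vector of length 8 taking only the values `c` and `c + 1` is determined by
its sum. -/
theorem eq_ite_of_antitone_of_sum_eq {f : Fin 8 → ℤ} (hf : Antitone f) (c k : ℤ)
    (hval : ∀ i, f i = c ∨ f i = c + 1) (hsum : ∑ i, f i = 8 * c + k) :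
    f = fun i : Fin 8 => if (i : ℤ) < k then c + 1 else c := by
  have hanti := Fin.antitone_iff_succ_le.1 hf
  simp [Fin.forall_fin_succ] at hanti
  simp only [Fin.forall_fin_succ] at hval
  simp at hval
  simp only [Fin.sum_univ_eight] at hsum
  ext i
  fin_cases i <;> simp <;> split_ifs <;> lia

/-- Up to permutation, the last coordinates of a `(−1)`-class are determined by its degree. -/
theorem exists_perm_cons_mem {d : ℤ} {f : Fin 8 → ℤ} (hsum : ∑ i, f i = 3 * d - 1)
    (hsq : ∑ i, f i ^ 2 = d ^ 2 + 1) :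
    ∃ σ : Equiv.Perm (Fin 8), (Fin.cons d (f ∘ σ) : Fin 9 → ℤ) ∈
      ({![0,-1,0,0,0,0,0,0,0], ![1,1,1,0,0,0,0,0,0], ![2,1,1,1,1,1,0,0,0],
        ![3,2,1,1,1,1,1,1,0], ![4,2,2,2,1,1,1,1,1], ![5,2,2,2,2,2,2,1,1],
        ![6,3,2,2,2,2,2,2,2]} : Set (Fin 9 → ℤ)) := by
  obtain ⟨hlo, hhi⟩ := degree_mem_Icc hsum hsq
  have hanti : Antitone (f ∘ Tuple.sort (-f)) := fun i j hij =>
    neg_le_neg_iff.1 (Tuple.monotone_sort (-f) hij)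
  set σ := Tuple.sort (-f)
  rw [← Equiv.sum_comp σ] at hsum
  rw [← Equiv.sum_comp σ (fun i => f i ^ 2)] at hsq
  have hstep (c k : ℤ) (hk : 3 * d - 1 = 8 * c + k)
      (hd : d ^ 2 + 1 = (2 * c + 1) * (3 * d - 1) - 8 * (c * (c + 1))) :
      f ∘ σ = fun i : Fin 8 => if (i : ℤ) < k then c + 1 else c :=
    eq_ite_of_antitone_of_sum_eq hanti c k
      (eq_or_eq_add_one_of_sum_sq c (by simpa [hsum, hsq] using hd)) (hsum.trans hk)
  interval_cases d
  · refine ⟨Fin.revPerm.trans σ, .inl ?_⟩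
    rw [Equiv.coe_trans, ← Function.comp_assoc, hstep (-1) 7 (by norm_num) (by norm_num)]
    decide
  · exact ⟨σ, by rw [hstep 0 2 (by norm_num) (by norm_num)]; decide⟩
  · exact ⟨σ, by rw [hstep 0 5 (by norm_num) (by norm_num)]; decide⟩
  · exact ⟨σ, by rw [eq_of_antitone_of_sum_eq_eight hanti hsum hsq]; decide⟩
  · exact ⟨σ, by rw [hstep 1 3 (by norm_num) (by norm_num)]; decide⟩
  · exact ⟨σ, by rw [hstep 1 6 (by norm_num) (by norm_num)]; decide⟩
  · exact ⟨σ, by rw [hstep 2 1 (by norm_num) (by norm_num)]; decide⟩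

/-- A `(−1)`-class in `ℤ⁹` (the Picard lattice of a degree 1 del Pezzo surface) is,
up to a permutation of the coordinates `1,…,8`, one of the seven listed vectors:
the class of an exceptional curve, a line through 2 points, a conic through 5 points,
a cubic through 7 points nodal at one of them, a quartic with 3 nodes, a quintic with
6 nodes, or a sextic with 7 nodes and one triple point. -/
theorem minusOneClasses_deg1 (v : Fin 9 → ℤ) :
    (lorentzForm v v = -1 ∧ lorentzForm v kappa = -1) ↔
      ∃ σ : Equiv.Perm (Fin 8),
        (Fin.cons (v 0) (fun j : Fin 8 => v (σ j).succ) : Fin 9 → ℤ) ∈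
          ({![0,-1,0,0,0,0,0,0,0], ![1,1,1,0,0,0,0,0,0], ![2,1,1,1,1,1,0,0,0],
            ![3,2,1,1,1,1,1,1,0], ![4,2,2,2,1,1,1,1,1], ![5,2,2,2,2,2,2,1,1],
            ![6,3,2,2,2,2,2,2,2]} : Set (Fin 9 → ℤ)) := by
  rw [lorentzForm_self_and_kappa_iff]
  constructor
  · rintro ⟨hsum, hsq⟩
    exact exists_perm_cons_mem hsum hsq
  · rintro ⟨σ, hσ⟩
    rw [← Equiv.sum_comp σ, ← Equiv.sum_comp σ (fun i => v i.succ ^ 2)]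
    rcases hσ with h | h | h | h | h | h | h <;>
    · obtain ⟨h0, hs⟩ := Fin.cons_inj.1 h
      simp only [funext_iff] at hs
      simp [hs, h0, Fin.sum_univ_eight]
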